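/- Let A ⋊_σ G be a skew group ring where G is an orderable abelian group (i.e. G admits a total order compatible with the group operation). If Z(A ⋊_σ G) is a field, then Z(A ⋊_σ G) ⊆ A (identifying A with A·u_e). -/

import Mathlib

/-- `R`, together with a ring embedding `ι : A →+* R` and a family `u : G → R` of
distinguished elements, is a skew group ring `A ⋊_σ G`: the `u g` satisfy
`u 1 = 1`, `u g * u h = u (g * h)`, the twisted commutation rule
`u g * ι a = ι (σ g a) * u g` (which forces `(a u_g)(b u_h) = a σ_g(b) u_{gh}`),
and `R` is a free left `A`-module with basis `{u g}_{g ∈ G}`, i.e. every element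
of `R` is uniquely a finite sum `∑ a_g u_g`. -/
def IsSkewGroupRing {A G R : Type*} [Ring A] [Group G] [Ring R]
    (σ : G →* RingAut A) (ι : A →+* R) (u : G → R) : Prop :=
  u 1 = 1 ∧
  (∀ g h : G, u g * u h = u (g * h)) ∧
  (∀ (g : G) (a : A), u g * ι a = ι (σ g a) * u g) ∧
  (∀ r : R, ∃! f : G →₀ A, r = f.sum fun g a => ι a * u g)

/-- `A` is `G`-simple: the only `G`-invariant (two-sided) ideals of `A` are `{0}` and `A`. -/
def IsGSimple {A G : Type*} [Ring A] [Group G] (σ : G →* RingAut A) : Prop :=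
  ∀ I : TwoSidedIdeal A, (∀ (g : G) (a : A), a ∈ I → σ g a ∈ I) → I = ⊥ ∨ I = ⊤

namespace IsSkewGroupRing

section Group

variable {A G R : Type*} [Ring A] [Group G] [Ring R] {σ : G →* RingAut A} {ι : A →+* R} {u : G → R}

theorem mul_homogeneous (h : IsSkewGroupRing σ ι u) (a b : A) (g k : G) :
    ι a * u g * (ι b * u k) = ι (a * σ g b) * u (g * k) := by
  obtain ⟨-, hmul, hcomm, -⟩ := h
  rw [← hmul, map_mul, mul_assoc, ← mul_assoc (u g), hcomm]
  simp only [mul_assoc]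

/-- The additive isomorphism sending an element of a skew group ring to its family of
coefficients. -/
noncomputable def coeff (h : IsSkewGroupRing σ ι u) : R ≃+ (G →₀ A) :=
  (AddEquiv.ofBijective
    (Finsupp.liftAddHom fun g => (AddMonoidHom.mulRight (u g)).comp ι.toAddMonoidHom) <| by
      rw [Function.bijective_iff_existsUnique]
      intro r
      convert h.2.2.2 r using 2
      exact eq_comm).symm

theorem coeff_symm_single (h : IsSkewGroupRing σ ι u) (g : G) (a : A) :
    h.coeff.symm (Finsupp.single g a) = ι a * u g := by
  simp [coeff]

theorem coeff_homogeneous (h : IsSkewGroupRing σ ι u) (g : G) (a : A) :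
    h.coeff (ι a * u g) = Finsupp.single g a := by
  rw [← coeff_symm_single h, AddEquiv.apply_symm_apply]

theorem coeff_one (h : IsSkewGroupRing σ ι u) : h.coeff 1 = Finsupp.single 1 1 := by
  simpa [h.1] using h.coeff_homogeneous 1 1

/-- To prove an additive property of all elements, it suffices to treat homogeneous ones. -/
theorem induction_on (h : IsSkewGroupRing σ ι u) {p : R → Prop} (r : R) (zero : p 0)
    (add : ∀ x y, p x → p y → p (x + y)) (homogeneous : ∀ g a, p (ι a * u g)) : p r := by
  rw [← h.coeff.symm_apply_apply r]
  induction h.coeff r using Finsupp.induction_linear with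
  | zero => simpa using zero
  | add f f' hf hf' => simpa using add _ _ hf hf'
  | single g a => simpa only [coeff_symm_single] using homogeneous g a

theorem coeff_homogeneous_mul (h : IsSkewGroupRing σ ι u) (g k : G) (a : A) (r : R) :
    h.coeff (ι a * u g * r) (g * k) = a * σ g (h.coeff r k) := by
  classical
  induction r using h.induction_on with
  | zero => simp
  | add x y hx hy => simp [mul_add, hx, hy]
  | homogeneous k' b =>
    simp only [mul_homogeneous h, coeff_homogeneous, Finsupp.single_apply, mul_right_inj]
    split_ifs <;> simp

theorem coeff_mul_homogeneous (h : IsSkewGroupRing σ ι u) (g k : G) (a : A) (r : R) :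
    h.coeff (r * (ι a * u g)) (k * g) = h.coeff r k * σ k a := by
  classical
  induction r using h.induction_on with
  | zero => simp
  | add x y hx hy => simp [add_mul, hx, hy]
  | homogeneous k' b =>
    simp only [mul_homogeneous h, coeff_homogeneous, Finsupp.single_apply, mul_left_inj]
    split_ifs with hk <;> simp [hk]

theorem mul_coeff_of_mem_center (h : IsSkewGroupRing σ ι u) {r : R}
    (hr : r ∈ Subring.center R) (a : A) (g : G) :
    a * h.coeff r g = h.coeff r g * σ g a := by
  have key := h.coeff_homogeneous_mul 1 g a r
  rw [Subring.mem_center_iff.mp hr, one_mul] at key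
  simpa using key.symm.trans (by simpa using h.coeff_mul_homogeneous 1 g a r)

/-- If `1 + x` is invertible with `x` a homogeneous regular element, then `x` has torsion
degree. -/
theorem isOfFinOrder_of_one_add_homogeneous_mul_eq_one [Nontrivial A]
    (h : IsSkewGroupRing σ ι u) {g : G} {a : A} {y : R} (ha : ∀ b, a * σ g b = 0 → b = 0)
    (hy : (1 + ι a * u g) * y = 1) : IsOfFinOrder g := by
  classical
  by_contra hg
  have hcoeff (k : G) :
      h.coeff y (g * k) + a * σ g (h.coeff y k) = Finsupp.single 1 (1 : A) (g * k) := by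
    rw [← coeff_one h, ← hy, add_mul, one_mul, map_add, Finsupp.add_apply,
      coeff_homogeneous_mul]
  have hstep {k : G} (hk : g * k ≠ 1) : h.coeff y (g * k) = 0 ↔ h.coeff y k = 0 := by
    have e := hcoeff k
    rw [Finsupp.single_eq_of_ne hk] at e
    refine ⟨fun h0 => ha _ (by simpa [h0] using e), fun h0 => by simpa [h0] using e⟩
  have hpow : Function.Injective fun n : ℕ => g ^ n :=
    injective_pow_iff_not_isOfFinOrder.mpr hg
  have hexists {f : ℕ → G} (hf : Function.Injective f) : ∃ n, h.coeff y (f n) = 0 := by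
    by_contra! hne
    exact Set.infinite_range_of_injective hf <| (h.coeff y).hasFiniteSupport.subset <|
      Set.range_subset_iff.mpr hne
  have hpow_ne (n : ℕ) : g ^ (n + 1) ≠ 1 := fun e => by
    simpa using hpow (e.trans (pow_zero g).symm)
  have hone : h.coeff y 1 = 0 := by
    obtain ⟨n, hn⟩ := hexists hpow
    induction n with
    | zero => simpa using hn
    | succ n ih =>
      have hne := hpow_ne n
      simp only [pow_succ'] at hn hne
      exact ih ((hstep hne).mp hn)
  have hinv : h.coeff y g⁻¹ = 0 := by
    have hinj : Function.Injective fun n : ℕ => (g ^ (n + 1))⁻¹ := fun m n e => by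
      simpa using hpow (inv_injective e)
    obtain ⟨n, hn⟩ := hexists hinj
    induction n with
    | zero => simpa using hn
    | succ n ih =>
      have e : (g ^ (n + 1))⁻¹ = g * (g ^ (n + 1 + 1))⁻¹ := by
        rw [pow_succ g (n + 1), mul_inv_rev, mul_inv_cancel_left]
      have hne : g * (g ^ (n + 1 + 1))⁻¹ ≠ 1 := e ▸ inv_ne_one.mpr (hpow_ne n)
      exact ih (by simpa only [e] using (hstep hne).mpr hn)
  simpa [hone, hinv] using hcoeff g⁻¹

end Group

section CommGroup

variable {A G R : Type*} [Ring A] [CommGroup G] [Ring R] {σ : G →* RingAut A} {ι : A →+* R}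
  {u : G → R}

theorem map_coeff_of_mem_center (h : IsSkewGroupRing σ ι u) {r : R}
    (hr : r ∈ Subring.center R) (k g : G) : σ k (h.coeff r g) = h.coeff r g := by
  have key := h.coeff_homogeneous_mul k g 1 r
  rw [Subring.mem_center_iff.mp hr, mul_comm k g, coeff_mul_homogeneous] at key
  simpa using key.symm

/-- The homogeneous components of a central element are central. -/
theorem homogeneous_mem_center (h : IsSkewGroupRing σ ι u) {r : R}
    (hr : r ∈ Subring.center R) (g : G) : ι (h.coeff r g) * u g ∈ Subring.center R := by
  rw [Subring.mem_center_iff]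
  intro x
  induction x using h.induction_on with
  | zero => simp
  | add x y hx hy => simp [mul_add, add_mul, hx, hy]
  | homogeneous k b =>
    rw [mul_homogeneous h, mul_homogeneous h, map_coeff_of_mem_center h hr,
      mul_coeff_of_mem_center h hr, mul_comm k g]

theorem coeff_eq_zero_of_mem_center [IsMulTorsionFree G] (h : IsSkewGroupRing σ ι u)
    (hZ : IsField (Subring.center R)) {r : R} (hr : r ∈ Subring.center R) {g : G}
    (hg : g ≠ 1) : h.coeff r g = 0 := by
  by_contra ha
  have : Nontrivial A := ⟨_, _, ha⟩
  set x : Subring.center R := ⟨_, h.homogeneous_mem_center hr g⟩ with hx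
  have hx0 : x ≠ 0 := fun e => ha <| by
    have e' := congrArg h.coeff (congrArg Subtype.val e)
    simpa [hx, coeff_homogeneous] using e'
  have hx1 : 1 + x ≠ 0 := fun e => by
    have e' := congrArg (fun z : R => h.coeff z 1) (congrArg Subtype.val e)
    simp [hx, coeff_homogeneous, coeff_one, Finsupp.single_eq_of_ne hg.symm] at e'
  obtain ⟨y, hy⟩ := hZ.mul_inv_cancel hx1
  obtain ⟨z, hz⟩ := hZ.mul_inv_cancel hx0
  refine hg ((isOfFinOrder_iff_eq_one g).mp ?_)
  refine h.isOfFinOrder_of_one_add_homogeneous_mul_eq_one (a := h.coeff r g) (y := y) ?_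
    (congrArg Subtype.val hy)
  intro b hb
  have hxb : (x : R) * (ι b * u 1) = 0 := by simp [hx, mul_homogeneous h, hb]
  have hb0 : ι b * u 1 = 0 := by
    have hzx : (z : R) * x = 1 := congrArg Subtype.val ((hZ.mul_comm z x).trans hz)
    rw [← one_mul (ι b * u 1), ← hzx, mul_assoc, hxb, mul_zero]
  simpa [coeff_homogeneous] using congrArg h.coeff hb0

end CommGroup

end IsSkewGroupRing

/-- **Lemma 4.3(c).** Let `A ⋊_σ G` be a skew group ring where `G` is an orderable abelian
group (here: `G` carries a linear order compatible with multiplication on both sides).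
If `Z(A ⋊_σ G)` is a field, then `Z(A ⋊_σ G) ⊆ A` (identified with `A·u_e`). -/
theorem center_subset_of_center_isField {A G R : Type*} [Ring A] [CommGroup G]
    [LinearOrder G] [CovariantClass G G (· * ·) (· < ·)]
    [CovariantClass G G (Function.swap (· * ·)) (· < ·)] [Ring R]
    (σ : G →* RingAut A) (ι : A →+* R) (u : G → R)
    (h : IsSkewGroupRing σ ι u) (hZ : IsField (Subring.center R)) :
    (Subring.center R : Set R) ⊆ Set.range ι := by
  intro r hr
  refine ⟨h.coeff r 1, ?_⟩
  have hsingle : h.coeff r = Finsupp.single 1 (h.coeff r 1) := by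
    ext g
    by_cases hg : g = 1
    · simp [hg]
    · rw [Finsupp.single_eq_of_ne hg, h.coeff_eq_zero_of_mem_center hZ hr hg]
  apply h.coeff.injective
  simpa [h.1] using (h.coeff_homogeneous 1 (h.coeff r 1)).trans hsingle.symm
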